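/- Let n = 2r be an even integer with n ≥ 4 and let F be a field of arbitrary characteristic. Then the family of elements [T] of F[V], indexed by the canonical even-tableaux T, is linearly independent over F; in particular the map T ↦ [T] from canonical even-tableaux to F[V] is injective. -/

import Mathlib

open scoped Matrix

noncomputable section

namespace PR

/-- The polynomial ring `R[Y_{ij} : 1 ≤ i, j ≤ n]`, `n = 2r`. -/
abbrev PolyRing (r : ℕ) (R : Type*) [CommRing R] :=
  MvPolynomial (Fin (2 * r) × Fin (2 * r)) R

/-- The standard symplectic form matrix `J` (`n = 2r`). -/
def Jmat (r : ℕ) (R : Type*) [CommRing R] : Matrix (Fin (2 * r)) (Fin (2 * r)) R :=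
  Matrix.of fun i j =>
    if (j : ℕ) = (i : ℕ) + r then 1 else if (i : ℕ) = (j : ℕ) + r then -1 else 0

/-- The generic `n × n` matrix of indeterminates. -/
def Ygen (r : ℕ) (R : Type*) [CommRing R] :
    Matrix (Fin (2 * r)) (Fin (2 * r)) (MvPolynomial (Fin (2 * r) × Fin (2 * r)) R) :=
  Matrix.of fun i j => MvPolynomial.X (i, j)

/-- The defining ideal of the scheme `V`. -/
def VIdeal (r : ℕ) (R : Type*) [CommRing R] :
    Ideal (MvPolynomial (Fin (2 * r) × Fin (2 * r)) R) :=
  Ideal.span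
    ({p | ∃ i j, p = (Ygen r R + (Ygen r R)ᵀ) i j} ∪
     {p | ∃ i, p = Ygen r R i i} ∪
     {p | ∃ i j, p = ((Ygen r R)ᵀ * Jmat r (PolyRing r R) * Ygen r R) i j} ∪
     {p | ∃ k, p = (Matrix.charpoly (-(Jmat r (PolyRing r R) * Ygen r R)) - Polynomial.X ^ (2 * r)).coeff k})

/-- The coordinate ring `R[V]`. -/
abbrev FV (r : ℕ) (R : Type*) [CommRing R] :=
  MvPolynomial (Fin (2 * r) × Fin (2 * r)) R ⧸ VIdeal r R

/-- The pfaffian of an `m × m` matrix (nonzero only for even `m`), defined as a signed sum over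
permutations `σ` with `σ(2i-1) < σ(2i)` for each pair and `σ(1) < σ(3) < ⋯` (here 0-indexed). -/
def pf {m : ℕ} {R : Type*} [CommRing R] (A : Matrix (Fin m) (Fin m) R) : R :=
  ∑ σ ∈ Finset.univ.filter (fun σ : Equiv.Perm (Fin m) =>
      (∀ i : Fin (m / 2),
        σ ⟨2 * i.val, by have := i.isLt; omega⟩ < σ ⟨2 * i.val + 1, by have := i.isLt; omega⟩) ∧
      ∀ i j : Fin (m / 2), i < j →
        σ ⟨2 * i.val, by have := i.isLt; omega⟩ < σ ⟨2 * j.val, by have := j.isLt; omega⟩),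
    (Equiv.Perm.sign σ : ℤ) •
      ∏ i : Fin (m / 2),
        A (σ ⟨2 * i.val, by have := i.isLt; omega⟩) (σ ⟨2 * i.val + 1, by have := i.isLt; omega⟩)

/-- `[i₁, …, i₂ₗ]`: the pfaffian of the submatrix of `Y` given by a list of indices. -/
def listPf {n : ℕ} {R : Type*} [CommRing R] (Y : Matrix (Fin n) (Fin n) R)
    (L : List (Fin n)) : R :=
  pf (Matrix.of fun a b : Fin L.length => Y (L.get a) (L.get b))

/-- The product of pfaffians associated to a tableau (rows as lists of entries),
as a polynomial. -/
def tabPoly (r : ℕ) (R : Type*) [CommRing R] (T : List (List (Fin (2 * r)))) :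
    MvPolynomial (Fin (2 * r) × Fin (2 * r)) R :=
  (T.map (listPf (Ygen r R))).prod

/-- `[T]`, the class of the product of pfaffians of the rows of `T` in `R[V]`. -/
def tabElem (r : ℕ) (R : Type*) [CommRing R] (T : List (List (Fin (2 * r)))) : FV r R :=
  Ideal.Quotient.mk (VIdeal r R) (tabPoly r R T)

/-- Position of an index in the order `1̄ ≺ 1 ≺ 2̄ ≺ 2 ≺ ⋯ ≺ r̄ ≺ r`, where `ī := r + i`
(0-indexed: `ī` is `r + i - 1` and `i` is `i - 1`). -/
def ordIdx (r : ℕ) (x : Fin (2 * r)) : ℕ :=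
  if x.val < r then 2 * x.val + 1 else 2 * (x.val - r)

/-- A list of rows represents a tableau of shape a partition: row lengths weakly decreasing
and positive. -/
def IsShape {α : Type*} (T : List (List α)) : Prop :=
  (T.map List.length).Chain' (fun a b => b ≤ a) ∧ ∀ row ∈ T, row ≠ []

/-- An even-tableau: every row has even length. -/
def IsEvenTab {α : Type*} (T : List (List α)) : Prop :=
  ∀ row ∈ T, Even row.length

/-- Standard: entries strictly increase along each row and weakly increase down each column,
with respect to the order `≺`. -/
def IsStandard (r : ℕ) (T : List (List (Fin (2 * r)))) : Prop :=
  (∀ row ∈ T, row.Chain' (fun a b => ordIdx r a < ordIdx r b)) ∧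
  ∀ (i t : ℕ) (hi : i + 1 < T.length) (ht' : t < (T[i]'(Nat.lt_of_succ_lt hi)).length)
    (ht : t < (T[i + 1]'hi).length),
    ordIdx r ((T[i]'(Nat.lt_of_succ_lt hi))[t]'ht') ≤ ordIdx r ((T[i + 1]'hi)[t]'ht)

/-- The symplectic condition: the entries `p` and `p̄` (0-indexed: values `p` and `r + p`
for `p < r`) occur only in the first `p + 1` columns (0-indexed: columns `t ≤ p`). -/
def IsSymplectic (r : ℕ) (T : List (List (Fin (2 * r)))) : Prop :=
  ∀ (i t : ℕ) (hi : i < T.length) (ht : t < (T[i]'hi).length) (p : ℕ), p < r →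
    (((T[i]'hi)[t]'ht).val = p ∨ ((T[i]'hi)[t]'ht).val = r + p) → t ≤ p

/-- A symplectic standard even-tableau. -/
def IsSSET (r : ℕ) (T : List (List (Fin (2 * r)))) : Prop :=
  IsShape T ∧ IsEvenTab T ∧ IsStandard r T ∧ IsSymplectic r T

/-- A canonical tableau: in column `j` only `j̄` appears (0-indexed: column `t` contains
only the value `r + t`). -/
def IsCanonical (r : ℕ) (T : List (List (Fin (2 * r)))) : Prop :=
  ∀ (i t : ℕ) (hi : i < T.length) (ht : t < (T[i]'hi).length), ((T[i]'hi)[t]'ht).val = r + t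

/-- The set `V(C)` of matrices. -/
def MemV (r : ℕ) {C : Type*} [CommRing C] (Y : Matrix (Fin (2 * r)) (Fin (2 * r)) C) : Prop :=
  Y = -Yᵀ ∧ (∀ i, Y i i = 0) ∧ Yᵀ * Jmat r C * Y = 0 ∧
    Matrix.charpoly (-(Jmat r C * Y)) = Polynomial.X ^ (2 * r)

/-- The embedding `i ↦ i` of `{1, …, r}` into `{1, …, n}`. -/
def emb (r : ℕ) (i : Fin r) : Fin (2 * r) := ⟨i.val, by have := i.isLt; omega⟩

/-- The embedding `i ↦ ī = r + i` of `{1, …, r}` into `{1, …, n}`. -/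
def embBar (r : ℕ) (i : Fin r) : Fin (2 * r) := ⟨r + i.val, by have := i.isLt; omega⟩

/-- The index list of `[P, Q̄]`: with `Γ₀ = P ∩ Q = {γ₁ < ⋯ < γ_λ}`, the list
`γ₁, γ̄₁, …, γ_λ, γ̄_λ` followed by `P ∖ Γ₀` in increasing order and then the bars of
`Q ∖ Γ₀` in increasing order. -/
def pqList (r : ℕ) (P Q : Finset (Fin r)) : List (Fin (2 * r)) :=
  ((P ∩ Q).sort (· ≤ ·)).flatMap (fun γ => [emb r γ, embBar r γ]) ++
    ((P \ Q).sort (· ≤ ·)).map (emb r) ++ ((Q \ P).sort (· ≤ ·)).map (embBar r)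

/-- The pfaffian `[P, Q̄]` of the matrix `Y`. -/
def pfPQ (r : ℕ) {C : Type*} [CommRing C] (Y : Matrix (Fin (2 * r)) (Fin (2 * r)) C)
    (P Q : Finset (Fin r)) : C :=
  listPf Y (pqList r P Q)

/-- The defining ideal of the scheme `W`. -/
def WIdeal (r : ℕ) (R : Type*) [CommRing R] : Ideal (PolyRing r R) :=
  Ideal.span
    ({p | ∃ i j, p = (Jmat r (PolyRing r R) * (Ygen r R)ᵀ * Jmat r (PolyRing r R)
            + Ygen r R) i j} ∪
     {p | ∃ i j, p = (Ygen r R * Ygen r R) i j} ∪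
     {p | ∃ k, p = (Matrix.charpoly (Ygen r R) - Polynomial.X ^ (2 * r)).coeff k})

/-- The coordinate ring `R[W]`. -/
abbrev FW (r : ℕ) (R : Type*) [CommRing R] := PolyRing r R ⧸ WIdeal r R

section Evaluation

variable {r : ℕ} {R S : Type*} [CommRing R] [CommRing S]

theorem map_pf {m : ℕ} (f : R →+* S) (A : Matrix (Fin m) (Fin m) R) :
    f (pf A) = pf (A.map f) := by
  simp only [pf, map_sum, map_zsmul, map_prod, Matrix.map_apply]

theorem Jmat_map (f : R →+* S) : (Jmat r R).map f = Jmat r S := by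
  ext i j
  simp only [Jmat, Matrix.map_apply, Matrix.of_apply]
  split_ifs <;> simp

variable [Algebra R S]

/-- Evaluation of the generic matrix at `Y`. -/
def evalAt (r : ℕ) (R : Type*) [CommRing R] [Algebra R S]
    (Y : Matrix (Fin (2 * r)) (Fin (2 * r)) S) : PolyRing r R →ₐ[R] S :=
  MvPolynomial.aeval fun p => Y p.1 p.2

theorem evalAt_Ygen (Y : Matrix (Fin (2 * r)) (Fin (2 * r)) S) (i j : Fin (2 * r)) :
    evalAt r R Y (Ygen r R i j) = Y i j := by
  simp [evalAt, Ygen]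

theorem Ygen_map_evalAt (Y : Matrix (Fin (2 * r)) (Fin (2 * r)) S) :
    (Ygen r R).map (evalAt r R Y : PolyRing r R →+* S) = Y := by
  ext i j
  exact evalAt_Ygen Y i j

theorem evalAt_listPf (Y : Matrix (Fin (2 * r)) (Fin (2 * r)) S) (L : List (Fin (2 * r))) :
    evalAt r R Y (listPf (Ygen r R) L) = listPf Y L := by
  have h := map_pf (evalAt r R Y : PolyRing r R →+* S)
    (Matrix.of fun a b : Fin L.length => Ygen r R (L.get a) (L.get b))
  refine h.trans ?_
  unfold listPf
  congr 1
  ext a b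
  exact evalAt_Ygen Y _ _

theorem evalAt_tabPoly (Y : Matrix (Fin (2 * r)) (Fin (2 * r)) S)
    (T : List (List (Fin (2 * r)))) :
    evalAt r R Y (tabPoly r R T) = (T.map (listPf Y)).prod := by
  rw [tabPoly, map_list_prod, List.map_map]
  congr 2
  funext L
  exact evalAt_listPf Y L

/-- Points of `V` kill the defining ideal. -/
theorem MemV.evalAt_eq_zero {Y : Matrix (Fin (2 * r)) (Fin (2 * r)) S} (hY : MemV r Y)
    {p : PolyRing r R} (hp : p ∈ VIdeal r R) : evalAt r R Y p = 0 := by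
  obtain ⟨halt, hdiag, hiso, hchar⟩ := hY
  set f : PolyRing r R →+* S := (evalAt r R Y : PolyRing r R →+* S) with hf
  have hfY : (Ygen r R).map f = Y := Ygen_map_evalAt Y
  have hfYt : ((Ygen r R)ᵀ).map f = Yᵀ := by rw [Matrix.transpose_map, hfY]
  suffices h : VIdeal r R ≤ RingHom.ker f from h hp
  refine Ideal.span_le.2 ?_
  rintro _ (((⟨i, j, rfl⟩ | ⟨i, rfl⟩) | ⟨i, j, rfl⟩) | ⟨k, rfl⟩)
  · change f _ = 0
    rw [← Matrix.map_apply (f := f), Matrix.map_add f (map_add f), hfY, hfYt]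
    nth_rewrite 1 [halt]
    simp
  · change f _ = 0
    rw [← Matrix.map_apply (f := f), hfY, hdiag]
  · change f _ = 0
    rw [← Matrix.map_apply (f := f), Matrix.map_mul, Matrix.map_mul, hfY, hfYt, Jmat_map, hiso]
    rfl
  · change f _ = 0
    rw [← Polynomial.coeff_map, Polynomial.map_sub, ← Matrix.charpoly_map, Polynomial.map_pow,
      Polynomial.map_X]
    have : (-(Jmat r (PolyRing r R) * Ygen r R)).map f = -(Jmat r S * Y) := by
      rw [Matrix.map_neg f (map_neg f), Matrix.map_mul, Jmat_map, hfY]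
    change (((-(Jmat r (PolyRing r R) * Ygen r R)).map f).charpoly - _).coeff k = 0
    rw [this, hchar, sub_self, Polynomial.coeff_zero]

end Evaluation

section BlockMatrix

variable {S : Type*} [CommRing S]

/-- The alternating matrix on `ℕ` whose only nonzero entries are `x k` at `(2k, 2k+1)` and
`-x k` at `(2k+1, 2k)`. -/
def hyperbolic (x : ℕ → S) (a b : ℕ) : S :=
  if Even a ∧ b = a + 1 then x (a / 2) else if Even b ∧ a = b + 1 then -x (b / 2) else 0

theorem hyperbolic_swap (x : ℕ → S) (a b : ℕ) : hyperbolic x a b = -hyperbolic x b a := by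
  unfold hyperbolic
  split_ifs <;> first | omega | simp

theorem hyperbolic_self (x : ℕ → S) (a : ℕ) : hyperbolic x a a = 0 := by
  simp [hyperbolic]

theorem eq_of_hyperbolic_ne_zero {x : ℕ → S} {a b : ℕ} (h : hyperbolic x a b ≠ 0)
    (hab : a < b) : Even a ∧ b = a + 1 := by
  unfold hyperbolic at h
  split_ifs at h <;> first | assumption | omega | exact absurd rfl h

theorem eq_one_of_paired {l m : ℕ} (hm : m = 2 * l) (σ : Equiv.Perm (Fin m))
    (hpair : ∀ i : Fin l, Even (σ ⟨2 * i, by omega⟩).val ∧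
      (σ ⟨2 * i + 1, by omega⟩).val = (σ ⟨2 * i, by omega⟩).val + 1)
    (hmono : ∀ i j : Fin l, i < j → σ ⟨2 * i, by omega⟩ < σ ⟨2 * j, by omega⟩) : σ = 1 := by
  let f : Fin l → Fin l := fun i => ⟨(σ ⟨2 * i, by omega⟩).val / 2, by omega⟩
  have hf : StrictMono f := by
    intro i j hij
    have h1 := hmono i j hij
    have h2 := (hpair i).1.two_dvd
    have h3 := (hpair j).1.two_dvd
    rw [Fin.lt_def] at h1 ⊢
    simp only [f]
    omega
  have hid : ∀ i, f i = i := fun i => le_antisymm hf.apply_le hf.le_apply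
  ext a
  have h := hid ⟨a.val / 2, by omega⟩
  have h' := congrArg Fin.val h
  obtain ⟨h1, h2⟩ := hpair ⟨a.val / 2, by omega⟩
  have h3 := h1.two_dvd
  simp only [f] at h' h1 h2 h3
  rcases Nat.even_or_odd' a.val with ⟨c, hc | hc⟩
  · have : (⟨2 * (a.val / 2), by omega⟩ : Fin m) = a := Fin.ext (by simp only []; omega)
    rw [this] at h' h3
    simp only [Equiv.Perm.coe_one, id_eq]
    omega
  · have : (⟨2 * (a.val / 2) + 1, by omega⟩ : Fin m) = a := Fin.ext (by simp only []; omega)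
    rw [this] at h2
    simp only [Equiv.Perm.coe_one, id_eq]
    omega

/-- Pfaffian of the leading block of the hyperbolic matrix. -/
theorem pf_hyperbolic (x : ℕ → S) {m : ℕ} (hm : Even m) :
    pf (Matrix.of fun a b : Fin m => hyperbolic x a b) = ∏ k ∈ Finset.range (m / 2), x k := by
  have hm2 : m = 2 * (m / 2) := by have := hm.two_dvd; omega
  unfold pf
  rw [Finset.sum_eq_single_of_mem 1]
  · rw [← Fin.prod_univ_eq_prod_range]
    simp [hyperbolic]
  · simp only [Finset.mem_filter, Finset.mem_univ, true_and, Equiv.Perm.coe_one, id_eq,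
      Fin.mk_lt_mk]
    exact ⟨fun i => Nat.lt_succ_self _, fun i j hij => by rw [Fin.lt_def] at hij; omega⟩
  · intro σ hσ hne
    rw [Finset.mem_filter] at hσ
    obtain ⟨-, hlt, hmono⟩ := hσ
    by_contra h
    refine hne (eq_one_of_paired hm2 σ (fun i => ?_) hmono)
    have hprod := right_ne_zero_of_smul h
    refine eq_of_hyperbolic_ne_zero (x := x) (fun h0 => hprod ?_) (hlt i)
    exact Finset.prod_eq_zero (Finset.mem_univ i) h0

/-- The hyperbolic matrix placed in the lower right block. -/
def cornerMat (r : ℕ) (x : ℕ → S) : Matrix (Fin (2 * r)) (Fin (2 * r)) S :=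
  Matrix.of fun i j => if r ≤ i.val ∧ r ≤ j.val then hyperbolic x (i - r) (j - r) else 0

theorem Jmat_mul_cornerMat_apply (r : ℕ) (x : ℕ → S) (i j : Fin (2 * r))
    (h : r ≤ i.val ∨ j.val < r) : (Jmat r S * cornerMat r x) i j = 0 := by
  rw [Matrix.mul_apply]
  refine Finset.sum_eq_zero fun k _ => ?_
  have hi := i.isLt
  have hj := j.isLt
  have hk := k.isLt
  simp only [Jmat, cornerMat, Matrix.of_apply]
  split_ifs <;> first | omega | simp

theorem memV_cornerMat (r : ℕ) (x : ℕ → S) : MemV r (cornerMat r x) := by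
  refine ⟨?_, fun i => ?_, ?_, ?_⟩
  · ext i j
    simp only [cornerMat, Matrix.neg_apply, Matrix.transpose_apply, Matrix.of_apply,
      and_comm (a := r ≤ j.val)]
    split_ifs
    · exact hyperbolic_swap x _ _
    · simp
  · simp [cornerMat, hyperbolic_self]
  · ext i j
    rw [Matrix.mul_assoc, Matrix.mul_apply]
    refine Finset.sum_eq_zero fun k _ => ?_
    by_cases hk : r ≤ k.val
    · rw [Jmat_mul_cornerMat_apply r x k j (Or.inl hk), mul_zero]
    · simp [cornerMat, hk]
  · have h0 : ∀ i j : Fin (2 * r), j ≤ i → (-(Jmat r S * cornerMat r x)) i j = 0 := by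
      intro i j hij
      rw [Matrix.neg_apply, Jmat_mul_cornerMat_apply, neg_zero]
      have : j.val ≤ i.val := hij
      omega
    rw [Matrix.charpoly_of_isUpperTriangular _ (fun i j hij => h0 i j (le_of_lt hij))]
    simp [h0 _ _ le_rfl]

theorem listPf_cornerMat {r : ℕ} (x : ℕ → S) {L : List (Fin (2 * r))} (hL : Even L.length)
    (hcan : ∀ (t : ℕ) (ht : t < L.length), (L[t]'ht).val = r + t) :
    listPf (cornerMat r x) L = ∏ k ∈ Finset.range (L.length / 2), x k := by
  rw [← pf_hyperbolic x hL]
  unfold listPf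
  congr 1
  ext a b
  simp [cornerMat, hcan]

end BlockMatrix

section Shapes

/-- The exponent vector of a product of monomials `x 0 ⋯ x (a - 1)`, for `a` running over a
list; it is the conjugate partition. -/
def conjExponent (l : List ℕ) : ℕ →₀ ℕ :=
  (l.map fun a => ∑ k ∈ Finset.range a, Finsupp.single k 1).sum

theorem conjExponent_apply (l : List ℕ) (k : ℕ) :
    conjExponent l k = l.countP (fun a => k < a) := by
  induction l with
  | nil => simp [conjExponent]
  | cons a l ih =>
    rw [List.countP_cons, ← ih]
    simp only [conjExponent, List.map_cons, List.sum_cons, Finsupp.add_apply,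
      Finsupp.finsetSum_apply, Finsupp.single_apply, Finset.sum_ite_eq', Finset.mem_range,
      decide_eq_true_eq]
    omega

theorem countP_lt_eq_count_add (l : List ℕ) (k : ℕ) :
    l.countP (fun a => k < a) = l.count (k + 1) + l.countP (fun a => k + 1 < a) := by
  induction l with
  | nil => simp
  | cons a l ih =>
    simp only [List.countP_cons, List.count_cons, ih, decide_eq_true_eq, beq_iff_eq]
    split_ifs <;> omega

theorem eq_of_conjExponent_eq {l l' : List ℕ} (hs : l.Pairwise (· ≥ ·))
    (hs' : l'.Pairwise (· ≥ ·)) (h0 : 0 ∉ l) (h0' : 0 ∉ l')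
    (h : conjExponent l = conjExponent l') : l = l' := by
  have hP : ∀ k, l.countP (fun a => k < a) = l'.countP (fun a => k < a) := fun k => by
    rw [← conjExponent_apply, ← conjExponent_apply, h]
  refine List.Perm.eq_of_pairwise' hs hs' (List.perm_iff_count.2 fun a => ?_)
  cases a with
  | zero => rw [List.count_eq_zero_of_not_mem h0, List.count_eq_zero_of_not_mem h0']
  | succ k =>
    have h1 := countP_lt_eq_count_add l k
    have h2 := countP_lt_eq_count_add l' k
    have h3 := hP k
    have h4 := hP (k + 1)
    omega

variable {r : ℕ} {T T' : List (List (Fin (2 * r)))}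

/-- Half the row lengths. -/
def halfShape {α : Type*} (T : List (List α)) : List ℕ :=
  T.map fun row => row.length / 2

theorem IsShape.pairwise_halfShape (h : IsShape T) : (halfShape T).Pairwise (· ≥ ·) := by
  have h1 : (T.map List.length).Pairwise (· ≥ ·) := List.isChain_iff_pairwise.1 h.1
  have h2 := h1.map (S := (· ≥ ·)) (· / 2) fun a b hab => Nat.div_le_div_right hab
  simpa [halfShape, Function.comp_def] using h2

theorem IsShape.zero_notMem_halfShape (h : IsShape T) (he : IsEvenTab T) : 0 ∉ halfShape T := by
  intro hmem
  obtain ⟨row, hrow, h0⟩ := List.mem_map.1 hmem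
  have h1 := List.length_pos_iff.2 (h.2 row hrow)
  have h2 := (he row hrow).two_dvd
  omega

theorem IsCanonical.getElem_val (h : IsCanonical r T) {row : List (Fin (2 * r))} (hrow : row ∈ T)
    (t : ℕ) (ht : t < row.length) : (row[t]'ht).val = r + t := by
  obtain ⟨i, hi, rfl⟩ := List.getElem_of_mem hrow
  exact h i t hi ht

theorem IsCanonical.eq_of_halfShape_eq (h : IsCanonical r T) (h' : IsCanonical r T')
    (he : IsEvenTab T) (he' : IsEvenTab T') (hs : halfShape T = halfShape T') : T = T' := by
  have hlen : T.length = T'.length := by simpa [halfShape] using congrArg List.length hs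
  refine List.ext_getElem hlen fun i hi hi' => ?_
  have hhalf : T[i].length / 2 = T'[i].length / 2 := by
    have h1 : (halfShape T)[i]'(by simpa [halfShape] using hi) =
        (halfShape T')[i]'(by simpa [halfShape] using hi') := by simp only [hs]
    simpa [halfShape] using h1
  have h1 := (he _ (List.getElem_mem hi)).two_dvd
  have h2 := (he' _ (List.getElem_mem hi')).two_dvd
  refine List.ext_getElem (by omega) fun t ht ht' => Fin.ext ?_
  rw [h i t hi ht, h' i t hi' ht']

end Shapes

theorem prod_listPf_cornerMat_X {r : ℕ} (F : Type*) [CommRing F]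
    {T : List (List (Fin (2 * r)))} (he : IsEvenTab T) (hc : IsCanonical r T) :
    (T.map (listPf (cornerMat r (MvPolynomial.X : ℕ → MvPolynomial ℕ F)))).prod =
      MvPolynomial.monomial (conjExponent (halfShape T)) 1 := by
  have h1 : T.map (listPf (cornerMat r (MvPolynomial.X : ℕ → MvPolynomial ℕ F))) =
      T.map fun row => ∏ k ∈ Finset.range (row.length / 2), MvPolynomial.X k :=
    List.map_congr_left fun row hrow =>
      listPf_cornerMat _ (he row hrow) (hc.getElem_val hrow)
  rw [h1]
  clear h1 he hc
  induction T with
  | nil => simp [halfShape, conjExponent]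
  | cons row T ih =>
    have h2 : conjExponent (halfShape (row :: T)) =
        (∑ k ∈ Finset.range (row.length / 2), Finsupp.single k 1) +
          conjExponent (halfShape T) := by
      simp [halfShape, conjExponent]
    rw [List.map_cons, List.prod_cons, ih, h2, ← one_mul (1 : F), ← MvPolynomial.monomial_mul,
      MvPolynomial.monomial_sum_one]
    simp [MvPolynomial.X]

/-- For `n = 2r ≥ 4` and any field `F`, the family `[T]`, indexed by the
canonical even-tableaux `T`, is linearly independent over `F`; in particular `T ↦ [T]`
is injective. -/
theorem linearIndependent_FV_canonical (r : ℕ) (hn : 4 ≤ 2 * r) (F : Type*) [Field F] :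
    (LinearIndependent F
      fun T : {T : List (List (Fin (2 * r))) // IsShape T ∧ IsEvenTab T ∧ IsCanonical r T} =>
        tabElem r F T.val) ∧
    Function.Injective
      (fun T : {T : List (List (Fin (2 * r))) // IsShape T ∧ IsEvenTab T ∧ IsCanonical r T} =>
        tabElem r F T.val) := by
  have hli : LinearIndependent F
      fun T : {T : List (List (Fin (2 * r))) // IsShape T ∧ IsEvenTab T ∧ IsCanonical r T} =>
        tabElem r F T.val := by
    let x : ℕ → MvPolynomial ℕ F := MvPolynomial.X
    let φ : FV r F →ₐ[F] MvPolynomial ℕ F :=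
      Ideal.Quotient.liftₐ (VIdeal r F) (evalAt r F (cornerMat r x))
        fun p hp => (memV_cornerMat r x).evalAt_eq_zero hp
    refine LinearIndependent.of_comp φ.toLinearMap ?_
    have hinj : Function.Injective fun T : {T : List (List (Fin (2 * r))) //
        IsShape T ∧ IsEvenTab T ∧ IsCanonical r T} => conjExponent (halfShape T.val) := by
      rintro ⟨T, hs, he, hc⟩ ⟨T', hs', he', hc'⟩ h
      exact Subtype.ext (hc.eq_of_halfShape_eq hc' he he'
        (eq_of_conjExponent_eq hs.pairwise_halfShape hs'.pairwise_halfShape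
          (hs.zero_notMem_halfShape he) (hs'.zero_notMem_halfShape he') h))
    have hmonomial : (φ.toLinearMap ∘ fun T : {T : List (List (Fin (2 * r))) //
          IsShape T ∧ IsEvenTab T ∧ IsCanonical r T} => tabElem r F T.val) =
        MvPolynomial.basisMonomials ℕ F ∘ fun T => conjExponent (halfShape T.val) := by
      funext T
      have h : φ (tabElem r F T.val) = evalAt r F (cornerMat r x) (tabPoly r F T.val) := rfl
      simp only [Function.comp_apply, AlgHom.toLinearMap_apply, h, evalAt_tabPoly,
        MvPolynomial.coe_basisMonomials]
      exact prod_listPf_cornerMat_X F T.prop.2.1 T.prop.2.2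
    rw [hmonomial]
    exact (MvPolynomial.basisMonomials ℕ F).linearIndependent.comp _ hinj
  exact ⟨hli, hli.injective⟩

end PR
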